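/- Let q be a prime power, F a finite field with q elements, and m ≥ 2, with either q even and m ≥ 3, or both q and m odd. Let M = [ H₂ᵀ | 𝟙 ] be the matrix over ZMod 2 whose rows are indexed by all points of F^m and whose columns are indexed by all lines of EG(m,q) together with one extra all-ones column, where the (p, L) entry is 1 iff point p lies on line L. Then every nonzero vector x (indexed by the columns of M) satisfying M · x = 0 over ZMod 2 has Hamming weight at least q + 1. (That is, the binary linear code with parity-check matrix M has minimum distance at least q + 1.) -/

import Mathlib

open Matrix

/-- A line of the Euclidean geometry `EG(m,q)`: a coset `a + F·b` of a one-dimensional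
linear subspace of `F^m`, realized as a `Finset` of points. -/
def IsLine (F : Type*) [Field F] [Fintype F] [DecidableEq F] (m : ℕ)
    (L : Finset (Fin m → F)) : Prop :=
  ∃ a b : Fin m → F, b ≠ 0 ∧ L = Finset.univ.image (fun t : F => a + t • b)

noncomputable instance (F : Type*) [Field F] [Fintype F] [DecidableEq F] (m : ℕ) :
    Fintype {L : Finset (Fin m → F) // IsLine F m L} :=
  Fintype.ofFinite _

/-- The matrix `M = [ H₂ᵀ | 𝟙 ]` over `ZMod 2`: rows indexed by all points of `F^m`,
columns indexed by all lines of `EG(m,q)` together with one extra all-ones column. -/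
def M7 (F : Type*) [Field F] [Fintype F] [DecidableEq F] (m : ℕ) :
    Matrix (Fin m → F) ({L : Finset (Fin m → F) // IsLine F m L} ⊕ Unit) (ZMod 2) :=
  Matrix.of fun p c =>
    Sum.elim (fun L => if p ∈ L.1 then 1 else 0) (fun _ => 1) c

theorem IsLine.card_eq {F : Type*} [Field F] [Fintype F] [DecidableEq F] {m : ℕ}
    {L : Finset (Fin m → F)} (hL : IsLine F m L) : L.card = Fintype.card F := by
  obtain ⟨a, b, hb, rfl⟩ := hL
  rw [Finset.card_image_of_injective, Finset.card_univ]
  intro s t hst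
  exact smul_left_injective F hb (add_left_cancel hst)

/-- A line is parametrized by any two of its distinct points. -/
theorem IsLine.eq_image {F : Type*} [Field F] [Fintype F] [DecidableEq F] {m : ℕ}
    {L : Finset (Fin m → F)} (hL : IsLine F m L) {p r : Fin m → F} (hp : p ∈ L) (hr : r ∈ L)
    (hpr : p ≠ r) : L = Finset.univ.image (fun u : F => p + u • (r - p)) := by
  symm
  refine Finset.eq_of_subset_of_card_le ?_ ?_
  · obtain ⟨a, b, -, rfl⟩ := hL
    simp only [Finset.mem_image, Finset.mem_univ, true_and] at hp hr
    obtain ⟨s, rfl⟩ := hp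
    obtain ⟨t, rfl⟩ := hr
    intro v hv
    simp only [Finset.mem_image, Finset.mem_univ, true_and] at hv ⊢
    obtain ⟨u, rfl⟩ := hv
    exact ⟨s + u * (t - s), by module⟩
  · rw [hL.card_eq]
    exact (IsLine.card_eq ⟨p, r - p, sub_ne_zero.2 hpr.symm, rfl⟩).ge

/-- Two lines sharing two distinct points are equal. -/
theorem IsLine.eq_of_mem {F : Type*} [Field F] [Fintype F] [DecidableEq F] {m : ℕ}
    {L K : Finset (Fin m → F)} (hL : IsLine F m L) (hK : IsLine F m K) {p r : Fin m → F}
    (hpr : p ≠ r) (hpL : p ∈ L) (hrL : r ∈ L) (hpK : p ∈ K) (hrK : r ∈ K) : L = K :=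
  (hL.eq_image hpL hrL hpr).trans (hK.eq_image hpK hrK hpr).symm

/-- If every point of every line of the nonempty family `S` lies on a second line of `S`, then
`S` has at least `q + 1` members. -/
theorem card_lt_card_of_covered_twice {F : Type*} [Field F] [Fintype F] [DecidableEq F] {m : ℕ}
    {S : Finset {L : Finset (Fin m → F) // IsLine F m L}} (hS : S.Nonempty)
    (h : ∀ L ∈ S, ∀ p ∈ L.1, ∃ K ∈ S, K ≠ L ∧ p ∈ K.1) : Fintype.card F < S.card := by
  classical
  obtain ⟨L, hL⟩ := hS
  have : Nonempty {L : Finset (Fin m → F) // IsLine F m L} := ⟨L⟩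
  choose! f hfS hfL hf using h L hL
  have hle : L.1.card ≤ (S.erase L).card := by
    refine Finset.card_le_card_of_injOn f
      (fun p hp => Finset.mem_erase.2 ⟨hfL p hp, hfS p hp⟩) ?_
    intro p hp r hr hpr
    by_contra hne
    exact hfL p hp (Subtype.ext ((f p).2.eq_of_mem L.2 hne (hf p hp) (hpr ▸ hf r hr) hp hr))
  rw [L.2.card_eq] at hle
  exact hle.trans_lt (Finset.card_erase_lt_of_mem hL)

/-- A family of lines covering a space of dimension at least two has at least `q` members. -/
theorem card_le_card_of_covered {F : Type*} [Field F] [Fintype F] [DecidableEq F] {m : ℕ}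
    (hm : 2 ≤ m) {S : Finset {L : Finset (Fin m → F) // IsLine F m L}}
    (h : ∀ p, ∃ L ∈ S, p ∈ L.1) : Fintype.card F ≤ S.card := by
  have hq : 0 < Fintype.card F := Fintype.card_pos
  have huniv : S.biUnion (fun L => L.1) = Finset.univ := by
    ext p
    simpa using h p
  have hcard := Finset.card_biUnion_le_card_mul S (fun L => L.1) (Fintype.card F)
    (fun L _ => L.2.card_eq.le)
  rw [huniv, Finset.card_univ, Fintype.card_fun, Fintype.card_fin] at hcard
  refine Nat.le_of_mul_le_mul_right (le_trans ?_ hcard) hq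
  rw [← sq]
  exact Nat.pow_le_pow_right hq hm

theorem stmt_7 (q : ℕ) (hq : IsPrimePow q) (F : Type*) [Field F] [Fintype F] [DecidableEq F]
    (hcard : Fintype.card F = q) (m : ℕ) (hm : 2 ≤ m)
    (h : (Even q ∧ 3 ≤ m) ∨ (Odd q ∧ Odd m))
    (x : ({L : Finset (Fin m → F) // IsLine F m L} ⊕ Unit) → ZMod 2)
    (hx : x ≠ 0) (hker : (M7 F m).mulVec x = 0) :
    q + 1 ≤ (Finset.univ.filter fun c => x c ≠ 0).card := by
  classical
  subst hcard
  have hsum : ∀ p, ∑ L, (if p ∈ L.1 then x (Sum.inl L) else 0) + x (Sum.inr ()) = 0 := by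
    intro p
    simpa [M7, Matrix.mulVec, dotProduct] using congrFun hker p
  set S := Finset.univ.filter fun L => x (Sum.inl L) ≠ 0 with hS
  have hmem : ∀ L, L ∈ S ↔ x (Sum.inl L) ≠ 0 := by simp [hS]
  have hcount : (Finset.univ.filter fun c => x c ≠ 0).card
      = S.card + if x (Sum.inr ()) ≠ 0 then 1 else 0 := by
    simp only [hS, Finset.card_filter, Fintype.sum_sum_type, Finset.univ_unique,
      Finset.sum_singleton, PUnit.default_eq_unit]
  rw [hcount]
  by_cases h0 : x (Sum.inr ()) = 0
  · rw [if_neg (not_not.2 h0), add_zero]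
    refine card_lt_card_of_covered_twice ?_ ?_
    · obtain ⟨L | u, hc⟩ := Function.ne_iff.1 hx
      · exact ⟨L, (hmem L).2 hc⟩
      · exact absurd h0 hc
    · intro L hL p hp
      by_contra! hK
      have hp_sum := hsum p
      rw [h0, add_zero, Finset.sum_eq_single L, if_pos hp] at hp_sum
      · exact (hmem L).1 hL hp_sum
      · intro K _ hKL
        by_cases hKS : K ∈ S
        · exact if_neg (hK K hKS hKL)
        · rw [not_not.1 (mt (hmem K).2 hKS), ite_self]
      · exact fun hL' => absurd (Finset.mem_univ L) hL'
  · rw [if_pos h0]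
    refine Nat.succ_le_succ (card_le_card_of_covered hm fun p => ?_)
    by_contra! hK
    have hp_sum := hsum p
    rw [Finset.sum_eq_zero, zero_add] at hp_sum
    · exact h0 hp_sum
    · intro K _
      by_cases hKS : K ∈ S
      · exact if_neg (hK K hKS)
      · rw [not_not.1 (mt (hmem K).2 hKS), ite_self]
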